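/- Let m ≥ n ≥ 2 be integers and ξ a transcendental real number. If w_{n-1}(ξ) < w_m(ξ), then ŵ_n(ξ) ≤ m + (n-1)·ŵ_n(ξ)/w_m(ξ). -/

import Mathlib

open Polynomial Filter

/-- Height of an integer polynomial: the maximum absolute value of its coefficients. -/
noncomputable def polyHeight (P : Polynomial ℤ) : ℝ :=
  ((P.support.sup fun i => (P.coeff i).natAbs : ℕ) : ℝ)

/-- `P` and `Q` have no common non-constant factor in `ℤ[X]`. -/
def CoprimePoly (P Q : Polynomial ℤ) : Prop :=
  ∀ d : Polynomial ℤ, d ∣ P → d ∣ Q → d.natDegree = 0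

/-- The exponent `w_n(ξ)`. -/
noncomputable def wExp (n : ℕ) (ξ : ℝ) : EReal :=
  sSup {x : EReal | ∃ w : ℝ, x = (w : EReal) ∧
    {P : Polynomial ℤ | P.natDegree ≤ n ∧ 0 < |Polynomial.aeval ξ P| ∧
      |Polynomial.aeval ξ P| ≤ (polyHeight P) ^ (-w)}.Infinite}

/-- The uniform exponent `ŵ_n(ξ)`. -/
noncomputable def whExp (n : ℕ) (ξ : ℝ) : EReal :=
  sSup {x : EReal | ∃ w : ℝ, x = (w : EReal) ∧
    ∀ᶠ H : ℝ in atTop, ∃ P : Polynomial ℤ, P.natDegree ≤ n ∧ polyHeight P ≤ H ∧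
      0 < |Polynomial.aeval ξ P| ∧ |Polynomial.aeval ξ P| ≤ H ^ (-w)}

/-- The exponent `w*_n(ξ)` of approximation by algebraic numbers of degree at most `n`;
the height of an algebraic number is the height of its irreducible defining polynomial. -/
noncomputable def wStarExp (n : ℕ) (ξ : ℝ) : EReal :=
  sSup {x : EReal | ∃ w : ℝ, x = (w : EReal) ∧
    {α : ℝ | ∃ P : Polynomial ℤ, Irreducible P ∧ Polynomial.aeval α P = 0 ∧
      P.natDegree ≤ n ∧ 0 < |ξ - α| ∧ |ξ - α| ≤ (polyHeight P) ^ (-w - 1)}.Infinite}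

/-- The uniform exponent `ŵ*_n(ξ)`. -/
noncomputable def whStarExp (n : ℕ) (ξ : ℝ) : EReal :=
  sSup {x : EReal | ∃ w : ℝ, x = (w : EReal) ∧
    ∀ᶠ H : ℝ in atTop, ∃ α : ℝ, ∃ P : Polynomial ℤ, Irreducible P ∧
      Polynomial.aeval α P = 0 ∧ P.natDegree ≤ n ∧ polyHeight P ≤ H ∧
      0 < |ξ - α| ∧ |ξ - α| ≤ (polyHeight P)⁻¹ * H ^ (-w)}

theorem abs_coeff_le_polyHeight (P : ℤ[X]) (i : ℕ) : |((P.coeff i : ℤ) : ℝ)| ≤ polyHeight P := by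
  unfold polyHeight
  rw [← Int.cast_abs, Int.abs_eq_natAbs, Int.cast_natCast, Nat.cast_le]
  by_cases hi : i ∈ P.support
  · exact Finset.le_sup (f := fun i => (P.coeff i).natAbs) hi
  · simp [notMem_support_iff.mp hi]

theorem polyHeight_le_of_abs_coeff_le {P : ℤ[X]} {B : ℝ} (hB : 0 ≤ B)
    (h : ∀ i, |((P.coeff i : ℤ) : ℝ)| ≤ B) : polyHeight P ≤ B := by
  unfold polyHeight
  refine (Nat.le_floor_iff hB).mp (Finset.sup_le fun i _ => (Nat.le_floor_iff hB).mpr ?_)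
  have := h i
  rwa [← Int.cast_abs, Int.abs_eq_natAbs, Int.cast_natCast] at this

theorem one_le_polyHeight {P : ℤ[X]} (hP : P ≠ 0) : 1 ≤ polyHeight P := by
  refine le_trans ?_ (abs_coeff_le_polyHeight P P.natDegree)
  rw [← Int.cast_abs]
  exact_mod_cast Int.one_le_abs (leadingCoeff_ne_zero.mpr hP)

theorem polyHeight_le_mahlerMeasure {P : ℤ[X]} {m : ℕ} (hP : P.natDegree ≤ m) :
    polyHeight P ≤ 2 ^ m * (P.map (Int.castRingHom ℂ)).mahlerMeasure := by
  refine polyHeight_le_of_abs_coeff_le (mul_nonneg (by positivity) (mahlerMeasure_nonneg _))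
    fun i => ?_
  have h := norm_coeff_le_choose_mul_mahlerMeasure i (P.map (Int.castRingHom ℂ))
  rw [natDegree_map_eq_of_injective (Int.castRingHom ℂ).injective_int, coeff_map, eq_intCast,
    Complex.norm_intCast] at h
  refine h.trans (mul_le_mul_of_nonneg_right ?_ (mahlerMeasure_nonneg _))
  exact_mod_cast (Nat.choose_le_two_pow _ _).trans (Nat.pow_le_pow_right two_pos hP)

theorem mahlerMeasure_le_polyHeight {P : ℤ[X]} {m : ℕ} (hP : P.natDegree ≤ m) :
    (P.map (Int.castRingHom ℂ)).mahlerMeasure ≤ (m + 1) * polyHeight P := by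
  refine (mahlerMeasure_le_sum_norm_coeff _).trans ?_
  rw [sum_over_range' _ (by simp) (m + 1) (Nat.lt_succ_of_le (natDegree_map_le.trans hP))]
  refine (Finset.sum_le_card_nsmul _ _ (polyHeight P) fun i _ => ?_).trans (by simp)
  rw [coeff_map, eq_intCast, Complex.norm_intCast]
  exact abs_coeff_le_polyHeight P i

theorem finite_polyHeight_le (m : ℕ) (B : ℝ) :
    {P : ℤ[X] | P.natDegree ≤ m ∧ polyHeight P ≤ B}.Finite := by
  refine (finite_mahlerMeasure_le m (Real.toNNReal ((m + 1) * B))).subset fun P hP => ⟨hP.1, ?_⟩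
  refine (mahlerMeasure_le_polyHeight hP.1).trans ((mul_le_mul_of_nonneg_left hP.2 ?_).trans
    (Real.le_coe_toNNReal _))
  positivity

theorem abs_det_le_of_combination {N : ℕ} (M : Matrix (Fin N) (Fin N) ℝ) (v c : Fin N → ℝ)
    (ε : ℝ) (i₀ : Fin N) (hv : v i₀ = 1) (hM : ∀ i j, |M i j| ≤ c j)
    (hvM : ∀ j, |∑ i, v i * M i j| ≤ ε * c j) :
    |M.det| ≤ N.factorial * (ε * ∏ j, c j) := by
  have hdet : M.det = (M.updateRow i₀ (∑ k, v k • M k)).det := by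
    rw [Matrix.det_updateRow_sum, hv, one_smul]
  rw [hdet, Matrix.det_apply]
  refine (Finset.abs_sum_le_sum_abs _ _).trans
    ((Finset.sum_le_card_nsmul _ _ (ε * ∏ j, c j) fun σ _ => ?_).trans ?_)
  · have h1 : ε * ∏ j, c j = ∏ j, ((if j = σ.symm i₀ then ε else 1) * c j) := by
      rw [Finset.prod_mul_distrib, Finset.prod_ite_eq' Finset.univ]
      simp
    have h2 : ∀ x : ℝ, |Equiv.Perm.sign σ • x| = |x| := by
      intro x
      rcases Int.units_eq_one_or (Equiv.Perm.sign σ) with h | h <;> simp [h]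
    rw [h2, h1, Finset.abs_prod]
    refine Finset.prod_le_prod (fun _ _ => abs_nonneg _) fun j _ => ?_
    by_cases hj : σ j = i₀
    · have : j = σ.symm i₀ := by simp [← hj]
      simpa [hj, ← this, Matrix.updateRow_self, Finset.sum_apply] using hvM j
    · have : j ≠ σ.symm i₀ := fun h => hj (by simp [h])
      simpa [hj, this, Matrix.updateRow_ne] using hM (σ j) j
  · simp [Fintype.card_perm]

theorem sum_pow_mul_shifted_coeff {N j d : ℕ} (hN : j + d < N) {g : ℝ[X]} (hg : g.natDegree ≤ d)
    (x : ℝ) :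
    ∑ i : Fin N, x ^ (i : ℕ) * (if (i : ℕ) ∈ Set.Icc j (j + d) then g.coeff (i - j) else 0) =
      x ^ j * g.eval x := by
  have h : (X ^ j * g).natDegree < N :=
    (natDegree_mul_le.trans (add_le_add (natDegree_X_pow_le j) hg)).trans_lt hN
  have h2 := eval_eq_sum_range' h x
  rw [eval_mul, eval_pow, eval_X] at h2
  rw [h2, ← Fin.sum_univ_eq_sum_range (fun i => (X ^ j * g : ℝ[X]).coeff i * x ^ i) N]
  refine Finset.sum_congr rfl fun i _ => ?_
  rw [coeff_X_pow_mul', mul_comm]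
  congr 1
  by_cases h1 : j ≤ (i : ℕ)
  · by_cases h3 : (i : ℕ) ≤ j + d
    · simp [h1, h3]
    · simp only [Set.mem_Icc, h1, h3, and_false, if_false, if_true]
      rw [coeff_eq_zero_of_natDegree_lt]
      omega
  · simp [h1]

theorem resultant_ne_zero_of_irreducible {P Q : ℤ[X]} {n : ℕ} (hP : Irreducible P)
    (hP0 : 0 < P.natDegree) (hQn : Q.natDegree ≤ n) (hPQ : ¬ P ∣ Q) :
    resultant P Q P.natDegree n ≠ 0 := by
  have hprim : P.IsPrimitive := hP.isPrimitive hP0.ne'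
  have hinj : Function.Injective (Int.castRingHom ℚ) := (Int.castRingHom ℚ).injective_int
  have hirr := hprim.irreducible_iff_irreducible_map_fraction_map (K := ℚ) |>.mp hP
  have hcop : IsCoprime (P.map (Int.castRingHom ℚ)) (Q.map (Int.castRingHom ℚ)) := by
    refine hirr.coprime_iff_not_dvd.mpr fun hdvd => hPQ ?_
    exact hprim.dvd_of_fraction_map_dvd_fraction_map (K := ℚ) hdvd
  obtain ⟨l, rfl⟩ := exists_add_of_le hQn
  rw [resultant_add_right_deg _ _ _ _ _ le_rfl]
  refine mul_ne_zero (pow_ne_zero _ (leadingCoeff_ne_zero.mpr hP.ne_zero)) fun h0 => ?_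
  have h := resultant_ne_zero _ _ hcop
  rw [natDegree_map_eq_of_injective hinj, natDegree_map_eq_of_injective hinj,
    resultant_map_map, h0] at h
  simp at h

theorem one_le_of_irreducible_of_not_dvd {P Q : ℤ[X]} {n : ℕ} {ξ A B η : ℝ} (hP : Irreducible P)
    (hP0 : 0 < P.natDegree) (hQn : Q.natDegree ≤ n) (hPQ : ¬ P ∣ Q)
    (hA : polyHeight P ≤ A) (hB : polyHeight Q ≤ B)
    (hPA : |aeval ξ P| ≤ η * A) (hQB : |aeval ξ Q| ≤ η * B) :
    1 ≤ (P.natDegree + n).factorial *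
      (max 1 |ξ| ^ (P.natDegree + n) * η * (B ^ P.natDegree * A ^ n)) := by
  set k := P.natDegree with hk
  have hR := resultant_ne_zero_of_irreducible hP hP0 hQn hPQ
  have hR1 : (1 : ℝ) ≤ |((resultant P Q k n : ℤ) : ℝ)| := by
    rw [← Int.cast_abs]
    exact_mod_cast Int.one_le_abs hR
  refine hR1.trans ?_
  have hmap : ((resultant P Q k n : ℤ) : ℝ) =
      (sylvester (P.map (Int.castRingHom ℝ)) (Q.map (Int.castRingHom ℝ)) k n).det :=
    (resultant_map_map P Q k n (Int.castRingHom ℝ)).symm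
  have hA0 : 0 ≤ A := (abs_nonneg _).trans ((abs_coeff_le_polyHeight P 0).trans hA)
  have hB0 : 0 ≤ B := (abs_nonneg _).trans ((abs_coeff_le_polyHeight Q 0).trans hB)
  have hev : ∀ R : ℤ[X], (R.map (Int.castRingHom ℝ)).eval ξ = aeval ξ R := fun R => by
    rw [eval_map, aeval_def]; rfl
  have hpow : ∀ j ≤ k + n, |ξ ^ j| ≤ max 1 |ξ| ^ (k + n) := fun j hj => by
    rw [abs_pow]
    exact (pow_le_pow_left₀ (abs_nonneg _) (le_max_right _ _) j).trans
      (pow_le_pow_right₀ (le_max_left _ _) hj)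
  have hm0 : 0 ≤ max 1 |ξ| ^ (k + n) := by positivity
  rw [hmap]
  have key := abs_det_le_of_combination
    (sylvester (P.map (Int.castRingHom ℝ)) (Q.map (Int.castRingHom ℝ)) k n)
    (fun i => ξ ^ (i : ℕ)) (fun j => Fin.addCases (fun _ : Fin k => B) (fun _ : Fin n => A) j)
    (max 1 |ξ| ^ (k + n) * η) ⟨0, by omega⟩ (by simp) ?_ ?_
  · rw [Fin.prod_univ_add] at key
    simpa using key
  · intro i j
    induction j using Fin.addCases with
    | left j =>
      simp only [sylvester, Matrix.of_apply, Fin.addCases_left]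
      split_ifs
      · simpa using (abs_coeff_le_polyHeight Q _).trans hB
      · simpa using hB0
    | right j =>
      simp only [sylvester, Matrix.of_apply, Fin.addCases_right]
      split_ifs
      · simpa using (abs_coeff_le_polyHeight P _).trans hA
      · simpa using hA0
  · intro j
    induction j using Fin.addCases with
    | left j =>
      simp only [sylvester, Matrix.of_apply, Fin.addCases_left]
      rw [sum_pow_mul_shifted_coeff (by omega) (natDegree_map_le.trans hQn), hev, abs_mul,
        mul_assoc]
      exact mul_le_mul (hpow _ (by omega)) hQB (abs_nonneg _) hm0
    | right j =>
      simp only [sylvester, Matrix.of_apply, Fin.addCases_right]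
      rw [sum_pow_mul_shifted_coeff (by omega) natDegree_map_le, hev, abs_mul,
        mul_assoc]
      exact mul_le_mul (hpow _ (by omega)) hPA (abs_nonneg _) hm0

theorem abs_aeval_pos {ξ : ℝ} (hξ : Transcendental ℚ ξ) {P : ℤ[X]} (hP : P ≠ 0) :
    0 < |aeval ξ P| :=
  abs_pos.mpr fun h =>
    hξ ((IsFractionRing.isAlgebraic_iff ℤ ℚ ℝ).mp ⟨P, hP, h⟩)

theorem pow_natDegree_mul_mahlerMeasure_rpow_le {ξ δ b : ℝ} {m : ℕ} (hb : 0 ≤ b)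
    (hδ0 : 0 < δ)
    (hirr : ∀ R : ℤ[X], Irreducible R → R.natDegree ≤ m → 0 < R.natDegree →
      δ * (R.map (Int.castRingHom ℂ)).mahlerMeasure ^ (-b) ≤ |aeval ξ R|)
    (hδ1 : δ ≤ 1) (P : ℤ[X]) (hP : P ≠ 0) (hPm : P.natDegree ≤ m) :
    δ ^ P.natDegree * (P.map (Int.castRingHom ℂ)).mahlerMeasure ^ (-b) ≤ |aeval ξ P| := by
  have hconst : ∀ R : ℤ[X], R ≠ 0 → R.natDegree = 0 →
      δ ^ R.natDegree * (R.map (Int.castRingHom ℂ)).mahlerMeasure ^ (-b) ≤ |aeval ξ R| := by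
    intro R hR hR0
    obtain ⟨c, rfl⟩ := natDegree_eq_zero.mp hR0
    have hc : (1 : ℝ) ≤ |(c : ℝ)| := by
      rw [← Int.cast_abs]
      exact_mod_cast Int.one_le_abs (by simpa using hR)
    rw [natDegree_C, pow_zero, one_mul, map_C, mahlerMeasure_const, eq_intCast,
      Complex.norm_intCast, aeval_C, eq_intCast]
    exact (Real.rpow_le_one_of_one_le_of_nonpos hc (neg_nonpos.mpr hb)).trans hc
  induction P using WfDvdMonoid.induction_on_irreducible with
  | zero => exact absurd rfl hP
  | unit u hu => exact hconst u hP (natDegree_eq_zero_of_isUnit hu)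
  | mul a i ha hi ih =>
    rw [natDegree_mul hi.ne_zero ha] at hPm ⊢
    have h1 : δ ^ i.natDegree * (i.map (Int.castRingHom ℂ)).mahlerMeasure ^ (-b) ≤
        |aeval ξ i| := by
      rcases Nat.eq_zero_or_pos i.natDegree with h0 | h0
      · exact hconst i hi.ne_zero h0
      · refine le_trans (mul_le_mul_of_nonneg_right ?_
          (Real.rpow_nonneg (mahlerMeasure_nonneg _) _)) (hirr i hi (by omega) h0)
        exact pow_le_of_le_one hδ0.le hδ1 h0.ne'
    have h2 := ih ha (by omega)
    rw [Polynomial.map_mul, mahlerMeasure_mul,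
      Real.mul_rpow (mahlerMeasure_nonneg _) (mahlerMeasure_nonneg _), map_mul, abs_mul, pow_add]
    have h3 : 0 ≤ δ ^ a.natDegree * (a.map (Int.castRingHom ℂ)).mahlerMeasure ^ (-b) :=
      mul_nonneg (pow_nonneg hδ0.le _) (Real.rpow_nonneg (mahlerMeasure_nonneg _) _)
    calc _ = δ ^ i.natDegree * (i.map (Int.castRingHom ℂ)).mahlerMeasure ^ (-b) *
          (δ ^ a.natDegree * (a.map (Int.castRingHom ℂ)).mahlerMeasure ^ (-b)) := by ring
      _ ≤ _ := mul_le_mul h1 h2 h3 (abs_nonneg _)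

theorem exists_pos_forall_le_of_finite {α : Type*} {s : Set α} (hs : s.Finite) {f : α → ℝ}
    (hf : ∀ x ∈ s, 0 < f x) : ∃ δ : ℝ, 0 < δ ∧ ∀ x ∈ s, δ ≤ f x := by
  have h : ∀ᶠ δ in nhdsWithin (0 : ℝ) (Set.Ioi 0), ∀ x ∈ s, δ ≤ f x :=
    (Filter.eventually_all_finite hs).mpr fun x hx =>
      Filter.mem_of_superset (Ioc_mem_nhdsGT (hf x hx)) fun _ h => h.2
  have h0 : ∀ᶠ δ in nhdsWithin (0 : ℝ) (Set.Ioi 0), 0 < δ := self_mem_nhdsWithin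
  exact (h0.and h).exists

theorem infinite_irreducible_of_infinite {ξ b b' : ℝ} (hξ : Transcendental ℚ ξ) {m : ℕ}
    (hb : 0 ≤ b) (hbb' : b < b')
    (hinf : {P : ℤ[X] | P.natDegree ≤ m ∧ 0 < |aeval ξ P| ∧
      |aeval ξ P| ≤ polyHeight P ^ (-b')}.Infinite) :
    {P : ℤ[X] | Irreducible P ∧ P.natDegree ≤ m ∧ 0 < P.natDegree ∧
      |aeval ξ P| ≤ polyHeight P ^ (-b)}.Infinite := by
  intro hfin
  obtain ⟨ε, hε0, hεS⟩ := exists_pos_forall_le_of_finite hfin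
    (f := fun P => |aeval ξ P|) fun R hR => abs_aeval_pos hξ hR.1.ne_zero
  have h2m : 0 < (2 ^ m : ℝ) ^ (-b) := by positivity
  obtain ⟨δ, hδ0, hδ⟩ := exists_between (lt_min one_pos (lt_min h2m hε0))
  have hδ1 : δ ≤ 1 := (hδ.trans_le (min_le_left _ _)).le
  have hδ2 : δ ≤ (2 ^ m : ℝ) ^ (-b) :=
    (hδ.trans_le ((min_le_right _ _).trans (min_le_left _ _))).le
  have hδε : δ ≤ ε := (hδ.trans_le ((min_le_right _ _).trans (min_le_right _ _))).le
  have hbound : ∀ P : ℤ[X], P ≠ 0 → P.natDegree ≤ m →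
      δ ^ P.natDegree * (P.map (Int.castRingHom ℂ)).mahlerMeasure ^ (-b) ≤ |aeval ξ P| := by
    refine pow_natDegree_mul_mahlerMeasure_rpow_le hb hδ0 (fun R hR hRm hR0 => ?_) hδ1
    have hM1 := one_le_mahlerMeasure_of_ne_zero hR.ne_zero
    by_cases hRS : |aeval ξ R| ≤ polyHeight R ^ (-b)
    · refine le_trans ?_ (hδε.trans (hεS R ⟨hR, hRm, hR0, hRS⟩))
      exact mul_le_of_le_one_right hδ0.le
        (Real.rpow_le_one_of_one_le_of_nonpos hM1 (neg_nonpos.mpr hb))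
    · refine le_trans ?_ (not_le.mp hRS).le
      refine le_trans (mul_le_mul_of_nonneg_right hδ2 (by positivity)) ?_
      rw [← Real.mul_rpow (by positivity) (by positivity)]
      exact Real.rpow_le_rpow_of_nonpos (by linarith [one_le_polyHeight hR.ne_zero])
        (polyHeight_le_mahlerMeasure hRm) (neg_nonpos.mpr hb)
  have hlim := tendsto_rpow_atTop (sub_pos.mpr hbb')
  obtain ⟨H₀, hH₀⟩ := Filter.eventually_atTop.mp
    (hlim.eventually_gt_atTop ((δ ^ m * ((m : ℝ) + 1) ^ (-b))⁻¹))
  refine hinf ((finite_polyHeight_le m H₀).subset fun P hP => ⟨hP.1, ?_⟩)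
  by_contra! hlt
  have hP0 : P ≠ 0 := fun h => by simpa [h] using hP.2.1
  have hH1 := one_le_polyHeight hP0
  have hHpos : 0 < polyHeight P := by linarith
  have h1 := hH₀ _ hlt.le
  have h2 : δ ^ m * (((m : ℝ) + 1) * polyHeight P) ^ (-b) ≤ polyHeight P ^ (-b') := by
    refine le_trans ?_ ((hbound P hP0 hP.1).trans hP.2.2)
    refine mul_le_mul (pow_le_pow_of_le_one hδ0.le hδ1 hP.1) ?_ (by positivity) (by positivity)
    exact Real.rpow_le_rpow_of_nonpos (by linarith [one_le_mahlerMeasure_of_ne_zero hP0])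
      (mahlerMeasure_le_polyHeight hP.1) (neg_nonpos.mpr hb)
  rw [Real.mul_rpow (by positivity) hHpos.le, ← mul_assoc] at h2
  have h3 : polyHeight P ^ (-b') = polyHeight P ^ (-b) / polyHeight P ^ (b' - b) := by
    rw [← Real.rpow_sub hHpos]; congr 1; ring
  have hK : 0 < δ ^ m * ((m : ℝ) + 1) ^ (-b) := by positivity
  have h4 : 0 < polyHeight P ^ (-b) := by positivity
  rw [h3, le_div_iff₀ (by positivity)] at h2
  rw [inv_lt_iff_one_lt_mul₀ hK] at h1
  nlinarith

theorem false_of_exponents {ξ a b : ℝ} {m n : ℕ} (hξ : Transcendental ℚ ξ) (hn : 1 ≤ n)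
    (hma : (m : ℝ) < a) (hab : a ≤ b) (hexp : (n : ℝ) - 1 < b * (1 - m / a))
    (hinf : {P : ℤ[X] | Irreducible P ∧ P.natDegree ≤ m ∧ n ≤ P.natDegree ∧
      |aeval ξ P| ≤ polyHeight P ^ (-b)}.Infinite)
    (hunif : ∀ᶠ H : ℝ in atTop, ∃ Q : ℤ[X], Q.natDegree ≤ n ∧ polyHeight Q ≤ H ∧
      0 < |aeval ξ Q| ∧ |aeval ξ Q| ≤ H ^ (-a)) : False := by
  have ha : 0 < a := (Nat.cast_nonneg m).trans_lt hma
  have he : 0 < b * (1 - m / a) - ((n : ℝ) - 1) := sub_pos.mpr hexp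
  set K : ℝ := 2 * ((m + n).factorial * max 1 |ξ| ^ (m + n)) with hK
  obtain ⟨H₀, hH₀⟩ := Filter.eventually_atTop.mp
    (((tendsto_rpow_atTop he).eventually_gt_atTop K).and
      (Filter.eventually_forall_ge_atTop.mpr hunif))
  obtain ⟨P, ⟨hP, hPm, hPn, hPb⟩, hPH⟩ :=
    hinf.exists_notMem_finite (finite_polyHeight_le m H₀)
  replace hPH : H₀ < polyHeight P := by
    by_contra! h
    exact hPH ⟨hPm, h⟩
  obtain ⟨hAK, hAX⟩ := hH₀ _ hPH.le
  set A := polyHeight P with hA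
  have hA1 : 1 ≤ A := one_le_polyHeight hP.ne_zero
  have hA0 : 0 < A := by linarith
  set p := |aeval ξ P| with hp
  have hp0 : 0 < p := abs_aeval_pos hξ hP.ne_zero
  have hpb : p / 2 ≤ A ^ (-b) := by linarith
  set Y := (p / 2) ^ (-1 / a) with hY
  have hY0 : 0 < Y := by positivity
  have hYa : Y ^ (-a) = p / 2 := by
    rw [hY, ← Real.rpow_mul (by positivity), show -1 / a * -a = 1 by field_simp, Real.rpow_one]
  have hAY : A ≤ Y := by
    have h1 : p / 2 ≤ A ^ (-a) :=
      hpb.trans (Real.rpow_le_rpow_of_exponent_le hA1 (by linarith))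
    have h2 : (A ^ (-a)) ^ (-1 / a) = A := by
      rw [← Real.rpow_mul hA0.le, show -a * (-1 / a) = 1 by field_simp, Real.rpow_one]
    rw [← h2]
    exact Real.rpow_le_rpow_of_nonpos (by positivity) h1
      (div_nonpos_of_nonpos_of_nonneg (by norm_num) ha.le)
  obtain ⟨Q, hQn, hQY, hQ0, hQa⟩ := hAX Y hAY
  rw [hYa] at hQa
  have hQne : Q ≠ 0 := fun h => by simp [h] at hQ0
  have hndvd : ¬ P ∣ Q := by
    rintro ⟨R, rfl⟩
    have hR : R ≠ 0 := right_ne_zero_of_mul hQne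
    rw [natDegree_mul hP.ne_zero hR] at hQn
    obtain ⟨c, rfl⟩ := natDegree_eq_zero.mp (show R.natDegree = 0 by omega)
    have hc : (1 : ℝ) ≤ |(c : ℝ)| := by
      rw [← Int.cast_abs]
      exact_mod_cast Int.one_le_abs (by simpa using hR)
    rw [map_mul, abs_mul, ← hp, aeval_C, eq_intCast] at hQa
    nlinarith
  have hk0 : 0 < P.natDegree := by omega
  have hres := one_le_of_irreducible_of_not_dvd (ξ := ξ) (A := A) (B := Y) (η := p / A) hP hk0
    hQn hndvd le_rfl hQY (by rw [div_mul_cancel₀ _ hA0.ne']) ?_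
  swap
  · rw [div_mul_eq_mul_div, le_div_iff₀ hA0]
    nlinarith
  have hpY : p * Y ^ m = 2 * (p / 2) ^ (1 - m / a) := by
    rw [hY, ← Real.rpow_natCast, ← Real.rpow_mul (by positivity), sub_eq_add_neg,
      Real.rpow_add (by positivity), Real.rpow_one]
    have : -1 / a * (m : ℝ) = -(m / a) := by ring
    rw [this]
    ring
  have hexp0 : 0 ≤ 1 - m / a := by
    rw [sub_nonneg, div_le_one ha]
    exact hma.le
  have hpY2 : p * Y ^ m ≤ 2 * A ^ (-(b * (1 - m / a))) := by
    rw [hpY, ← neg_mul, Real.rpow_mul hA0.le]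
    gcongr
  have hAn : p / A * A ^ n = p * A ^ ((n : ℝ) - 1) := by
    rw [Real.rpow_sub_one hA0.ne', Real.rpow_natCast]
    ring
  have hY1 : 1 ≤ Y := hA1.trans hAY
  have hfinal : (1 : ℝ) ≤ K * A ^ (-(b * (1 - m / a) - ((n : ℝ) - 1))) := by
    calc (1 : ℝ) ≤ _ := hres
      _ ≤ (m + n).factorial * (max 1 |ξ| ^ (m + n) * (p / A) * (Y ^ m * A ^ n)) := by
        gcongr
        exact le_max_left _ _
      _ = (m + n).factorial * (max 1 |ξ| ^ (m + n)) * (p * Y ^ m * A ^ ((n : ℝ) - 1)) := by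
        rw [show p * Y ^ m * A ^ ((n : ℝ) - 1) = Y ^ m * (p * A ^ ((n : ℝ) - 1)) by ring, ← hAn]
        ring
      _ ≤ (m + n).factorial * (max 1 |ξ| ^ (m + n)) *
          (2 * A ^ (-(b * (1 - m / a))) * A ^ ((n : ℝ) - 1)) := by
        gcongr
      _ = K * A ^ (-(b * (1 - m / a) - ((n : ℝ) - 1))) := by
        rw [show -(b * (1 - m / a) - ((n : ℝ) - 1)) = -(b * (1 - m / a)) + ((n : ℝ) - 1) by ring,
          Real.rpow_add hA0, hK]
        ring
  rw [Real.rpow_neg hA0.le, ← div_eq_mul_inv, le_div_iff₀ (by positivity)] at hfinal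
  linarith

theorem wExp_nonneg {ξ : ℝ} (hξ : Transcendental ℚ ξ) {m : ℕ} (hm : 1 ≤ m) : 0 ≤ wExp m ξ := by
  refine le_sSup ⟨0, rfl, ?_⟩
  have hcoeff : ∀ k : ℕ, (C ((k : ℤ) + 1) * X - C ⌊((k : ℝ) + 1) * ξ⌋ : ℤ[X]).coeff 1 = k + 1 :=
    fun k => by
      rw [coeff_sub, coeff_C_mul, coeff_X_one, mul_one, coeff_C_of_ne_zero one_ne_zero, sub_zero]
  refine Set.infinite_of_injective_forall_mem
    (f := fun k : ℕ => C ((k : ℤ) + 1) * X - C ⌊((k : ℝ) + 1) * ξ⌋) ?_ fun k => ?_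
  · intro k l hkl
    have h := congrArg (fun P : ℤ[X] => P.coeff 1) hkl
    simp only [hcoeff] at h
    omega
  · have hne : (C ((k : ℤ) + 1) * X - C ⌊((k : ℝ) + 1) * ξ⌋ : ℤ[X]) ≠ 0 := fun h0 => by
      have h := hcoeff k
      rw [h0, coeff_zero] at h
      omega
    refine ⟨?_, abs_aeval_pos hξ hne, ?_⟩
    · rw [natDegree_sub_C]
      exact (natDegree_C_mul_le _ _).trans (natDegree_X_le.trans hm)
    · have : aeval ξ (C ((k : ℤ) + 1) * X - C ⌊((k : ℝ) + 1) * ξ⌋ : ℤ[X]) =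
          Int.fract (((k : ℝ) + 1) * ξ) := by
        rw [map_sub, map_mul, aeval_C, aeval_X, aeval_C, eq_intCast, eq_intCast]
        push_cast
        exact Int.self_sub_floor _
      rw [this, neg_zero, Real.rpow_zero, abs_of_nonneg (Int.fract_nonneg _)]
      exact (Int.fract_lt_one _).le

theorem whExp_nonneg (n : ℕ) (ξ : ℝ) : 0 ≤ whExp n ξ := by
  refine le_sSup ⟨0, rfl, ?_⟩
  filter_upwards [Filter.eventually_ge_atTop 1] with H hH
  refine ⟨1, by simp, ?_, by simp, by simp⟩
  exact polyHeight_le_of_abs_coeff_le (by linarith) fun i => by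
    rw [coeff_one]
    split_ifs <;> simp <;> linarith

theorem whExp_le_wExp {ξ : ℝ} (hξ : Transcendental ℚ ξ) {n m : ℕ} (hm : 1 ≤ m) (hnm : n ≤ m) :
    whExp n ξ ≤ wExp m ξ := by
  refine sSup_le ?_
  rintro _ ⟨w, rfl, hw⟩
  rcases le_or_gt w 0 with hw0 | hw0
  · exact le_trans (by exact_mod_cast hw0) (wExp_nonneg hξ hm)
  refine le_sSup ⟨w, rfl, fun hfin => ?_⟩
  obtain ⟨δ, hδ0, hδ⟩ := exists_pos_forall_le_of_finite hfin
    (f := fun P => |aeval ξ P|) fun P hP => hP.2.1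
  obtain ⟨H, ⟨P, hPn, hPH, hP0, hPw⟩, hHδ⟩ :=
    (hw.and ((tendsto_rpow_neg_atTop hw0).eventually_lt_const hδ0)).exists
  have hP : P ≠ 0 := fun h => by simp [h] at hP0
  refine (hPw.trans_lt hHδ).not_ge (hδ P ⟨hPn.trans hnm, hP0, hPw.trans ?_⟩)
  exact Real.rpow_le_rpow_of_nonpos (by linarith [one_le_polyHeight hP]) hPH (by linarith)

theorem false_of_lt_wExp {ξ a b : ℝ} {m n : ℕ} (hξ : Transcendental ℚ ξ) (hn : 1 ≤ n)
    (hma : (m : ℝ) < a) (hab : a ≤ b) (hexp : (n : ℝ) - 1 < b * (1 - m / a))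
    (ha : (a : EReal) < whExp n ξ) (hb : (b : EReal) < wExp m ξ)
    (hb' : wExp (n - 1) ξ < (b : EReal)) : False := by
  obtain ⟨_, ⟨a', rfl, ha'⟩, haa'⟩ := lt_sSup_iff.mp ha
  obtain ⟨_, ⟨b', rfl, hinf⟩, hbb'⟩ := lt_sSup_iff.mp hb
  rw [EReal.coe_lt_coe_iff] at haa' hbb'
  have hb0 : 0 ≤ b := (Nat.cast_nonneg m).trans (hma.le.trans hab)
  have hfin : {P : ℤ[X] | P.natDegree ≤ n - 1 ∧ 0 < |aeval ξ P| ∧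
      |aeval ξ P| ≤ polyHeight P ^ (-b)}.Finite := by
    by_contra h
    exact hb'.not_ge (le_sSup ⟨b, rfl, h⟩)
  refine false_of_exponents hξ hn hma hab hexp
    (((infinite_irreducible_of_infinite hξ hb0 hbb' hinf).sdiff hfin).mono ?_) ?_
  · rintro P ⟨⟨hP, hPm, -, hPb⟩, hPn⟩
    refine ⟨hP, hPm, ?_, hPb⟩
    by_contra h
    exact hPn ⟨by omega, abs_aeval_pos hξ hP.ne_zero, hPb⟩
  · filter_upwards [ha', Filter.eventually_ge_atTop 1] with H ⟨Q, hQn, hQH, hQ0, hQ⟩ hH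
    exact ⟨Q, hQn, hQH, hQ0,
      hQ.trans (Real.rpow_le_rpow_of_exponent_le hH (by linarith))⟩

theorem stmt4 (m n : ℕ) (hn : 2 ≤ n) (hmn : n ≤ m) (ξ : ℝ) (hξ : Transcendental ℚ ξ)
    (h : wExp (n - 1) ξ < wExp m ξ) :
    whExp n ξ ≤ (m : EReal) + ((n : EReal) - 1) * whExp n ξ / wExp m ξ := by
  by_contra! hlt
  have hw0 := wExp_nonneg hξ (show 1 ≤ m by omega)
  have hwh := whExp_le_wExp hξ (show 1 ≤ m by omega) hmn
  have hwh0 := whExp_nonneg n ξ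
  have hn1 : (0 : ℝ) ≤ (n : ℝ) - 1 := by
    have : (2 : ℝ) ≤ n := by exact_mod_cast hn
    linarith
  have hn1' : ((n : EReal) - 1) = (((n : ℝ) - 1 : ℝ) : EReal) := by
    push_cast
    rfl
  have hm' : (m : EReal) = ((m : ℝ) : EReal) := rfl
  have hm : ((m : ℝ) : EReal) < whExp n ξ := by
    refine lt_of_le_of_lt ?_ hlt
    rw [hn1', ← hm']
    exact le_add_of_nonneg_right
      (EReal.div_nonneg (mul_nonneg (EReal.coe_nonneg.mpr hn1) hwh0) hw0)
  obtain ⟨c, hc, hcw⟩ := EReal.lt_iff_exists_real_btwn.mp h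
  have key := fun a b => false_of_lt_wExp (a := a) (b := b) (m := m) hξ (show 1 ≤ n by omega)
  generalize wExp m ξ = w at *
  generalize whExp n ξ = wh at *
  induction w with
  | bot => simp at hw0
  | top =>
    obtain ⟨a, hma, ha⟩ := EReal.lt_iff_exists_real_btwn.mp hm
    rw [EReal.coe_lt_coe_iff] at hma
    have ha0 : 0 < a := (Nat.cast_nonneg m).trans_lt hma
    have hpos : 0 < 1 - m / a := by
      rw [sub_pos, div_lt_one ha0]
      exact hma
    refine key a (max (max a c) (n / (1 - m / a))) hma
      ((le_max_left _ _).trans (le_max_left _ _)) ?_ ha (EReal.coe_lt_top _) (hc.trans_le ?_)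
    · calc (n : ℝ) - 1 < n / (1 - m / a) * (1 - m / a) := by
            rw [div_mul_cancel₀ _ hpos.ne']
            linarith
        _ ≤ _ := mul_le_mul_of_nonneg_right (le_max_right _ _) hpos.le
    · exact EReal.coe_le_coe_iff.mpr ((le_max_right _ _).trans (le_max_left _ _))
  | coe r =>
    induction wh with
    | bot => simp at hwh0
    | top => simp at hwh
    | coe s =>
      rw [hn1', hm', ← EReal.coe_mul, ← EReal.coe_div, ← EReal.coe_add,
        EReal.coe_lt_coe_iff] at hlt
      rw [EReal.coe_lt_coe_iff] at hm hcw
      rw [EReal.coe_le_coe_iff] at hwh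
      have hs0 : 0 < s := (Nat.cast_nonneg m).trans_lt hm
      have hr0 : 0 < r := hs0.trans_le hwh
      have hval : (n : ℝ) - 1 < (r - 0) * (1 - m / (s - 0)) := by
        have h1 : ((n : ℝ) - 1) * s < (s - m) * r := by
          rw [← div_lt_iff₀ hr0]
          linarith
        rw [sub_zero, sub_zero, one_sub_div hs0.ne', ← mul_div_assoc, lt_div_iff₀ hs0]
        linarith
      have hcont : ContinuousAt (fun ε : ℝ => (r - ε) * (1 - m / (s - ε))) 0 := by
        refine ContinuousAt.mul (by fun_prop) (continuousAt_const.sub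
          (continuousAt_const.div (by fun_prop) (by simpa using hs0.ne')))
      have e1 : ∀ᶠ ε in nhds (0 : ℝ), (n : ℝ) - 1 < (r - ε) * (1 - m / (s - ε)) :=
        hcont.eventually_const_lt hval
      have e2 : ∀ᶠ ε in nhds (0 : ℝ), ε < min (s - m) (r - c) :=
        eventually_lt_nhds (lt_min (sub_pos.mpr hm) (sub_pos.mpr hcw))
      have e3 : ∀ᶠ ε in nhdsWithin (0 : ℝ) (Set.Ioi 0), 0 < ε := self_mem_nhdsWithin
      obtain ⟨ε, ⟨h1, h2⟩, h3⟩ := (((e1.and e2).filter_mono nhdsWithin_le_nhds).and e3).exists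
      obtain ⟨h4, h5⟩ := lt_min_iff.mp h2
      refine key (s - ε) (r - ε) (by linarith) (by linarith) h1 ?_ ?_ (hc.trans ?_) <;>
        · rw [EReal.coe_lt_coe_iff]
          linarith
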